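/- Suppose the operator L satisfies the positive maximum principle on M₊(E). Then b₀ is a positive linear functional: b₀(g) ≥ 0 for every g ∈ C(E) with g ≥ 0. Consequently there exists a finite nonnegative Borel measure b on E such that b₀(g) = ∫_E g db for all g ∈ C(E). -/

import Mathlib

open MeasureTheory Topology

/-- The topological support of a measure: points all of whose open neighborhoods
have positive measure. -/
def mSupport {E : Type*} [TopologicalSpace E] [MeasurableSpace E]
    (ν : Measure E) : Set E :=
  {x : E | ∀ U : Set E, IsOpen U → x ∈ U → 0 < ν U}

/-- The action of the operator `L` (with parameters `b₀, b₁, q₀, q₁, q₂`) on the cylindrical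
function `ν ↦ φ(⟨g₁,ν⟩, …, ⟨g_m,ν⟩)`, evaluated at `ν`. -/
noncomputable def Lapp {E : Type*} [MetricSpace E] [MeasurableSpace E]
    (b₀ : C(E, ℝ) →ₗ[ℝ] ℝ) (b₁ : C(E, ℝ) →ₗ[ℝ] C(E, ℝ))
    (q₀ : C(E, ℝ) →ₗ[ℝ] C(E, ℝ) →ₗ[ℝ] ℝ)
    (q₁ : C(E, ℝ) →ₗ[ℝ] C(E, ℝ) →ₗ[ℝ] C(E, ℝ))
    (q₂ : C(E, ℝ) →ₗ[ℝ] C(E, ℝ) →ₗ[ℝ] C(E × E, ℝ))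
    (m : ℕ) (φ : (Fin m → ℝ) → ℝ) (g : Fin m → C(E, ℝ)) (ν : FiniteMeasure E) : ℝ :=
  (∑ i, fderiv ℝ φ (fun k => ∫ x, g k x ∂(ν : Measure E)) (Pi.single i 1) *
      (b₀ (g i) + ∫ x, b₁ (g i) x ∂(ν : Measure E))) +
  (1 / 2) * ∑ i, ∑ j,
    (fderiv ℝ (fun w => fderiv ℝ φ w (Pi.single i 1))
        (fun k => ∫ x, g k x ∂(ν : Measure E)) (Pi.single j 1)) *
      (q₀ (g i) (g j) + (∫ x, q₁ (g i) (g j) x ∂(ν : Measure E)) +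
        ∫ p, q₂ (g i) (g j) p ∂((ν : Measure E).prod (ν : Measure E)))

/-- `φ : ℝ^m → ℝ` is a polynomial function. -/
def IsPolyFn {m : ℕ} (φ : (Fin m → ℝ) → ℝ) : Prop :=
  ∃ P : MvPolynomial (Fin m) ℝ, ∀ v, φ v = MvPolynomial.eval v P

/-- The operator `L` satisfies the positive maximum principle on `M₊(E)`: for every
cylindrical function `f(ν) = φ(⟨g₁,ν⟩, …, ⟨g_m,ν⟩)` whose outer function `φ` is smooth and
either a polynomial or compactly supported, and every global maximizer `ν*` of `f` over
`M₊(E)` with `f(ν*) ≥ 0`, one has `Lf(ν*) ≤ 0`. -/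
def SatisfiesPMP {E : Type*} [MetricSpace E] [MeasurableSpace E]
    (b₀ : C(E, ℝ) →ₗ[ℝ] ℝ) (b₁ : C(E, ℝ) →ₗ[ℝ] C(E, ℝ))
    (q₀ : C(E, ℝ) →ₗ[ℝ] C(E, ℝ) →ₗ[ℝ] ℝ)
    (q₁ : C(E, ℝ) →ₗ[ℝ] C(E, ℝ) →ₗ[ℝ] C(E, ℝ))
    (q₂ : C(E, ℝ) →ₗ[ℝ] C(E, ℝ) →ₗ[ℝ] C(E × E, ℝ)) : Prop :=
  ∀ (m : ℕ) (φ : (Fin m → ℝ) → ℝ), ContDiff ℝ (⊤ : ℕ∞) φ →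
    (IsPolyFn φ ∨ HasCompactSupport φ) →
    ∀ (g : Fin m → C(E, ℝ)) (νstar : FiniteMeasure E),
      (∀ ν : FiniteMeasure E,
        φ (fun i => ∫ x, g i x ∂(ν : Measure E)) ≤
          φ (fun i => ∫ x, g i x ∂(νstar : Measure E))) →
      0 ≤ φ (fun i => ∫ x, g i x ∂(νstar : Measure E)) →
      Lapp b₀ b₁ q₀ q₁ q₂ m φ g νstar ≤ 0

/-- A positive linear functional on `C(E, ℝ)`, with `E` compact Hausdorff, is integration against
a finite measure. -/
theorem exists_finiteMeasure_eq_integral_of_nonneg {E : Type*} [TopologicalSpace E] [T2Space E]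
    [CompactSpace E] [MeasurableSpace E] [BorelSpace E] (l : C(E, ℝ) →ₗ[ℝ] ℝ)
    (hl : ∀ g : C(E, ℝ), (∀ x, 0 ≤ g x) → 0 ≤ l g) :
    ∃ b : FiniteMeasure E, ∀ g : C(E, ℝ), l g = ∫ x, g x ∂(b : Measure E) := by
  let Λ : CompactlySupportedContinuousMap E ℝ →ₚ[ℝ] ℝ := PositiveLinearMap.mk₀
    { toFun := fun f => l f.toContinuousMap
      map_add' := fun f g => l.map_add f.toContinuousMap g.toContinuousMap
      map_smul' := fun c f => l.map_smul c f.toContinuousMap }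
    (fun f hf => hl f.toContinuousMap hf)
  exact ⟨⟨RealRMK.rieszMeasure Λ, inferInstance⟩, fun g =>
    (RealRMK.integral_rieszMeasure Λ
      (CompactlySupportedContinuousMap.continuousMapEquiv g)).symm⟩

/-- The functional `b₀` of an operator satisfying the positive maximum principle is positive:
test the principle on `ν ↦ -⟨g, ν⟩`, which is maximal at `ν = 0` when `g ≥ 0`. -/
theorem SatisfiesPMP.nonneg {E : Type*} [MetricSpace E] [MeasurableSpace E]
    {b₀ : C(E, ℝ) →ₗ[ℝ] ℝ} {b₁ : C(E, ℝ) →ₗ[ℝ] C(E, ℝ)}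
    {q₀ : C(E, ℝ) →ₗ[ℝ] C(E, ℝ) →ₗ[ℝ] ℝ}
    {q₁ : C(E, ℝ) →ₗ[ℝ] C(E, ℝ) →ₗ[ℝ] C(E, ℝ)}
    {q₂ : C(E, ℝ) →ₗ[ℝ] C(E, ℝ) →ₗ[ℝ] C(E × E, ℝ)}
    (h : SatisfiesPMP b₀ b₁ q₀ q₁ q₂) {g : C(E, ℝ)} (hg : ∀ x, 0 ≤ g x) : 0 ≤ b₀ g := by
  let φ : (Fin 1 → ℝ) →L[ℝ] ℝ := -ContinuousLinearMap.proj 0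
  have hL := h 1 φ φ.contDiff (Or.inl ⟨-MvPolynomial.X 0, fun v => by simp [φ]⟩) (fun _ => g) 0
    (fun ν => by simpa [φ] using integral_nonneg hg) (by simp [φ])
  simp only [Lapp, φ.fderiv] at hL
  simpa [φ] using hL

/-- If `L` satisfies the positive maximum principle on `M₊(E)`, then `b₀` is a positive
linear functional, hence represented by a finite nonnegative Borel measure `b`. -/
theorem stmt_8 {E : Type*} [MetricSpace E] [CompactSpace E] [MeasurableSpace E] [BorelSpace E]
    (b₀ : C(E, ℝ) →ₗ[ℝ] ℝ) (b₁ : C(E, ℝ) →ₗ[ℝ] C(E, ℝ))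
    (q₀ : C(E, ℝ) →ₗ[ℝ] C(E, ℝ) →ₗ[ℝ] ℝ)
    (q₁ : C(E, ℝ) →ₗ[ℝ] C(E, ℝ) →ₗ[ℝ] C(E, ℝ))
    (q₂ : C(E, ℝ) →ₗ[ℝ] C(E, ℝ) →ₗ[ℝ] C(E × E, ℝ))
    (hq₀ : ∀ g h : C(E, ℝ), q₀ g h = q₀ h g)
    (hq₁ : ∀ g h : C(E, ℝ), q₁ g h = q₁ h g)
    (hq₂ : ∀ g h : C(E, ℝ), q₂ g h = q₂ h g)
    (hq₂val : ∀ (g h : C(E, ℝ)) (x y : E), q₂ g h (x, y) = q₂ g h (y, x))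
    (hPMP : SatisfiesPMP b₀ b₁ q₀ q₁ q₂) :
    (∀ g : C(E, ℝ), (∀ x, 0 ≤ g x) → 0 ≤ b₀ g) ∧
    (∃ b : FiniteMeasure E, ∀ g : C(E, ℝ), b₀ g = ∫ x, g x ∂(b : Measure E)) := by
  exact ⟨fun _ hg => hPMP.nonneg hg,
    exists_finiteMeasure_eq_integral_of_nonneg b₀ fun _ hg => hPMP.nonneg hg⟩
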